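/- Let P = conv(v_0, …, v_d) ⊂ ℝ^d be a very ample lattice d-simplex that is not hollow, i.e., the interior of P contains at least one lattice point. Then k_P ≤ Vol(P) − |P ∩ M| + d + 1. -/

import Mathlib

open Set MeasureTheory
open scoped Pointwise

/-- A point of `ℝ^n` is a lattice point if all its coordinates are integers. -/
def IsLatticePt {n : ℕ} (x : Fin n → ℝ) : Prop := ∀ i, ∃ z : ℤ, x i = (z : ℝ)

/-- The set of lattice points of a subset of `ℝ^n`. -/
def latticePts {n : ℕ} (S : Set (Fin n → ℝ)) : Set (Fin n → ℝ) := {x ∈ S | IsLatticePt x}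

/-- `P` is `k`-normal: every lattice point of the dilate `k • P` is a sum of `k`
lattice points of `P`. -/
def IsKNormal {n : ℕ} (P : Set (Fin n → ℝ)) (k : ℕ) : Prop :=
  ∀ x ∈ latticePts ((k : ℝ) • P),
    ∃ u : Fin k → Fin n → ℝ, (∀ j, u j ∈ latticePts P) ∧ x = ∑ j, u j

/-- The `k`-normality `k_P`: the least positive integer such that `P` is `k`-normal for
all `k ≥ k_P`. -/
noncomputable def kNormality {n : ℕ} (P : Set (Fin n → ℝ)) : ℕ :=
  sInf {m | 0 < m ∧ ∀ k, m ≤ k → IsKNormal P k}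

/-- The real cone generated by a set `S` (for convex `S`, all nonnegative multiples of
points of `S`). -/
def coneOver {n : ℕ} (S : Set (Fin n → ℝ)) : Set (Fin n → ℝ) :=
  {x | ∃ t : ℝ, ∃ p ∈ S, 0 ≤ t ∧ x = t • p}

/-- `P` is very ample: for every vertex (= extreme point) `v` of `P`, every lattice point
of the real cone generated by `P - v` is a finite sum of elements of `(P ∩ M) - v`. -/
def IsVeryAmple {n : ℕ} (P : Set (Fin n → ℝ)) : Prop :=
  ∀ v ∈ P.extremePoints ℝ, ∀ x : Fin n → ℝ, IsLatticePt x →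
    x ∈ coneOver ((fun p => p - v) '' P) →
    ∃ (m : ℕ) (u : Fin m → Fin n → ℝ), (∀ j, u j ∈ latticePts P) ∧ x = ∑ j, (u j - v)

/-- The invariant `d_P`: the smallest positive integer such that
`(k+1)P ∩ M = (P ∩ M) + (kP ∩ M)` for all `k ≥ d_P`. -/
noncomputable def dInv {n : ℕ} (P : Set (Fin n → ℝ)) : ℕ :=
  sInf {m | 0 < m ∧ ∀ k : ℕ, m ≤ k →
    latticePts (((k : ℝ) + 1) • P) = latticePts P + latticePts ((k : ℝ) • P)}

/-- The invariant `ν_P` (relative to a set `V`, typically the vertex set of `P`): the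
smallest positive integer such that `(k+1)P ∩ M = V + (kP ∩ M)` for all `k ≥ ν_P`. -/
noncomputable def nuInv {n : ℕ} (V P : Set (Fin n → ℝ)) : ℕ :=
  sInf {m | 0 < m ∧ ∀ k : ℕ, m ≤ k →
    latticePts (((k : ℝ) + 1) • P) = V + latticePts ((k : ℝ) • P)}

/-- The normalized volume of `P ⊆ ℝ^n`: `n!` times its Euclidean (Lebesgue) volume. -/
noncomputable def nVol {n : ℕ} (P : Set (Fin n → ℝ)) : ℝ :=
  (n.factorial : ℝ) * (volume P).toReal

open Classical in
/-- The degree of a lattice `n`-polytope `P`: `n` if `P` has an interior lattice point,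
and otherwise the least `i ≥ 0` such that `(kP)° ∩ M = ∅` for all `1 ≤ k ≤ n - i`. -/
noncomputable def polyDeg {n : ℕ} (P : Set (Fin n → ℝ)) : ℕ :=
  if (latticePts (interior P)).Nonempty then n
  else sInf {i | ∀ k : ℕ, 1 ≤ k → k ≤ n - i → latticePts (interior ((k : ℝ) • P)) = ∅}

/-- The elements of `Λ` on the standard simplex. -/
def simplexPts {ι : Type*} [Fintype ι] (Λ : AddSubgroup (ι → ℝ)) : Set (ι → ℝ) :=
  {c | c ∈ Λ ∧ 0 ≤ c ∧ ∑ i, c i = 1}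

/-- The elements of `Λ` in the half-open unit cube. -/
def boxPts {ι : Type*} (Λ : AddSubgroup (ι → ℝ)) : Set (ι → ℝ) :=
  {c | c ∈ Λ ∧ ∀ i, 0 ≤ c i ∧ c i < 1}

/-- The additive monoid generated by `simplexPts Λ`. -/
def simplexMonoid {ι : Type*} [Fintype ι] (Λ : AddSubgroup (ι → ℝ)) : AddSubmonoid (ι → ℝ) :=
  AddSubmonoid.closure (simplexPts Λ)

/-- The coordinatewise fractional part. -/
noncomputable def fractVec {ι : Type*} (c : ι → ℝ) : ι → ℝ := fun i => Int.fract (c i)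

theorem fractVec_apply_eq {ι : Type*} {c : ι → ℝ} {l : ι} (h0 : 0 ≤ c l) (h1 : c l < 1) :
    fractVec c l = c l :=
  Int.fract_eq_self.2 ⟨h0, h1⟩

theorem fractVec_add_injOn {ι : Type*} {Λ : AddSubgroup (ι → ℝ)} (g : ι → ℝ) :
    Set.InjOn (fun e => fractVec (g + e)) (boxPts Λ) := by
  intro e he e' he' h
  ext i
  obtain ⟨z, hz⟩ := Int.fract_eq_fract.1 (congrFun h i)
  have h1 := he.2 i
  have h2 := he'.2 i
  simp only [Pi.add_apply] at hz
  have h3 : (z : ℝ) < 1 := by linarith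
  have h4 : (-1 : ℝ) < z := by linarith
  obtain rfl : z = 0 := by
    have h3' : z < 1 := by exact_mod_cast h3
    have h4' : -1 < z := by exact_mod_cast h4
    omega
  push_cast at hz
  linarith

section Monoid

variable {ι : Type*} [Fintype ι] {Λ : AddSubgroup (ι → ℝ)}

theorem simplexMonoid_induction {p : (ι → ℝ) → Prop} (zero : p 0)
    (add_left : ∀ q ∈ simplexPts Λ, ∀ s ∈ simplexMonoid Λ, p s → p (q + s))
    {s : ι → ℝ} (hs : s ∈ simplexMonoid Λ) : p s := by
  induction hs using AddSubmonoid.closure_induction_left with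
  | zero => exact zero
  | add_left x hx y hy h => exact add_left x hx y hy h

theorem mem_of_mem_simplexMonoid {s : ι → ℝ} (hs : s ∈ simplexMonoid Λ) : s ∈ Λ :=
  simplexMonoid_induction Λ.zero_mem (fun _ hq _ _ h => Λ.add_mem hq.1 h) hs

theorem nonneg_of_mem_simplexMonoid {s : ι → ℝ} (hs : s ∈ simplexMonoid Λ) : 0 ≤ s :=
  simplexMonoid_induction le_rfl (fun _ hq _ _ h => add_nonneg hq.2.1 h) hs

theorem simplexPts_subset {q : ι → ℝ} (hq : q ∈ simplexPts Λ) : q ∈ simplexMonoid Λ :=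
  AddSubmonoid.subset_closure hq

theorem sum_add_apply (x y : ι → ℝ) : ∑ i, (x + y) i = ∑ i, x i + ∑ i, y i := by
  simp [Finset.sum_add_distrib]

theorem exists_eq_add_of_mem_simplexMonoid {s : ι → ℝ} (hs : s ∈ simplexMonoid Λ) :
    s = 0 ∨ ∃ q ∈ simplexPts Λ, ∃ t ∈ simplexMonoid Λ, s = q + t :=
  simplexMonoid_induction
    (p := fun s => s = 0 ∨ ∃ q ∈ simplexPts Λ, ∃ t ∈ simplexMonoid Λ, s = q + t) (Or.inl rfl) (fun q hq t ht _ => Or.inr ⟨q, hq, t, ht, rfl⟩) hs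

theorem exists_fin_sum_of_mem_simplexMonoid (k : ℕ) :
    ∀ s ∈ simplexMonoid Λ, ∑ i, s i = k →
      ∃ u : Fin k → ι → ℝ, (∀ j, u j ∈ simplexPts Λ) ∧ s = ∑ j, u j := by
  induction k with
  | zero =>
    intro s hs h
    refine ⟨Fin.elim0, fun j => j.elim0, ?_⟩
    have h0 := (Finset.sum_eq_zero_iff_of_nonneg
      (fun i _ => nonneg_of_mem_simplexMonoid hs i)).1 (by simpa using h)
    ext i
    simpa using h0 i (Finset.mem_univ i)
  | succ k ih =>
    intro s hs h
    rcases exists_eq_add_of_mem_simplexMonoid hs with rfl | ⟨q, hq, t, ht, rfl⟩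
    · simp only [Pi.zero_apply, Finset.sum_const_zero] at h
      exact absurd h (by positivity)
    · rw [sum_add_apply, hq.2.2] at h
      obtain ⟨u, hu, rfl⟩ := ih t ht (by push_cast at h; linarith)
      refine ⟨Fin.cons q u, fun j => ?_, by simp [Fin.sum_univ_succ]⟩
      refine Fin.cases ?_ (fun j => ?_) j
      · simpa using hq
      · simpa using hu j

theorem eq_zero_of_sum_eq_zero {c : ι → ℝ} (hc : 0 ≤ c) (h : ∑ i, c i = 0) : c = 0 := by
  ext i
  exact (Finset.sum_eq_zero_iff_of_nonneg (fun i _ => hc i)).1 h i (Finset.mem_univ i)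

theorem two_le_sum_of_notMem (hint : ∀ c ∈ Λ, ∃ z : ℤ, ∑ i, c i = z) {c : ι → ℝ}
    (hc : c ∈ Λ) (h0 : 0 ≤ c) (hS : c ∉ simplexMonoid Λ) : 2 ≤ ∑ i, c i := by
  obtain ⟨z, hz⟩ := hint c hc
  have hz0 : 0 ≤ z := by
    have : 0 ≤ ∑ i, c i := Finset.sum_nonneg fun i _ => h0 i
    rw [hz] at this
    exact_mod_cast this
  by_contra! hlt
  rw [hz] at hlt
  have hlt' : z < 2 := by exact_mod_cast hlt
  apply hS
  obtain rfl | rfl : z = 0 ∨ z = 1 := by omega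
  · rw [eq_zero_of_sum_eq_zero h0 (by simpa using hz)]
    exact zero_mem _
  · exact simplexPts_subset ⟨hc, h0, by simpa using hz⟩

variable [DecidableEq ι]

theorem single_mem_simplexPts (hsingle : ∀ i, Pi.single i (1 : ℝ) ∈ Λ) (i : ι) :
    Pi.single i (1 : ℝ) ∈ simplexPts Λ :=
  ⟨hsingle i, by simp, by simp⟩

theorem natVec_eq_sum (a : ι → ℕ) :
    (fun i => (a i : ℝ)) = ∑ i, a i • (Pi.single i (1 : ℝ) : ι → ℝ) := by
  ext j
  simp [Finset.sum_apply, Pi.single_apply]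

theorem natVec_mem (hsingle : ∀ i, Pi.single i (1 : ℝ) ∈ Λ) (a : ι → ℕ) :
    (fun i => (a i : ℝ)) ∈ simplexMonoid Λ := by
  rw [natVec_eq_sum]
  exact sum_mem fun i _ => nsmul_mem (simplexPts_subset (single_mem_simplexPts hsingle i)) _

theorem intVec_mem (hsingle : ∀ i, Pi.single i (1 : ℝ) ∈ Λ) (a : ι → ℤ) :
    (fun i => (a i : ℝ)) ∈ Λ := by
  have : (fun i => (a i : ℝ)) = ∑ i, a i • (Pi.single i (1 : ℝ) : ι → ℝ) := by
    ext j
    simp [Finset.sum_apply, Pi.single_apply]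
  rw [this]
  exact sum_mem fun i _ => zsmul_mem (hsingle i) _

theorem fractVec_mem (hsingle : ∀ i, Pi.single i (1 : ℝ) ∈ Λ) {c : ι → ℝ} (hc : c ∈ Λ) :
    fractVec c ∈ boxPts Λ := by
  refine ⟨?_, fun i => ⟨Int.fract_nonneg _, Int.fract_lt_one _⟩⟩
  have : fractVec c = c - fun i => ((⌊c i⌋ : ℤ) : ℝ) := by
    ext i
    rfl
  rw [this]
  exact Λ.sub_mem hc (intVec_mem hsingle _)

/-- The fractional parts of the partial sums of an element of minimal height with prescribed
coordinates away from `i`. -/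
theorem exists_chain (hsingle : ∀ i, Pi.single i (1 : ℝ) ∈ Λ)
    (hint : ∀ c ∈ Λ, ∃ z : ℤ, ∑ i, c i = z) (i : ι) (n : ℕ) :
    ∀ s ∈ simplexMonoid Λ, ∑ l, s l = n → (∀ l, l ≠ i → s l < 1) →
      (∀ t ∈ simplexMonoid Λ, (∀ l, l ≠ i → t l = s l) → ∑ l, s l ≤ ∑ l, t l) →
      ∃ C : Finset (ι → ℝ), n ≤ C.card + 1 ∧
        ∀ e ∈ C, e ∈ boxPts Λ ∧ 2 ≤ ∑ l, e l ∧ ∀ l, l ≠ i → e l ≤ s l := by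
  induction n with
  | zero => exact fun s _ _ _ _ => ⟨∅, by simp⟩
  | succ n ih =>
    intro s hs hsum hlt hmin
    rcases Nat.eq_zero_or_pos n with rfl | hn
    · exact ⟨∅, by simp⟩
    rcases exists_eq_add_of_mem_simplexMonoid hs with rfl | ⟨q, hq, t, ht, rfl⟩
    · simp only [Pi.zero_apply, Finset.sum_const_zero] at hsum
      exact absurd hsum (by positivity)
    have hq0 := hq.2.1
    have ht0 := nonneg_of_mem_simplexMonoid ht
    have hs0 := nonneg_of_mem_simplexMonoid hs
    have hsum' : ∑ l, t l = n := by
      rw [sum_add_apply, hq.2.2] at hsum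
      push_cast at hsum
      linarith
    have hle : ∀ l, t l ≤ (q + t) l := fun l => by simpa using hq0 l
    obtain ⟨C, hcard, hC⟩ := ih t ht hsum' (fun l hl => (hle l).trans_lt (hlt l hl)) (by
      intro t' ht' h
      have := hmin (q + t') (add_mem (simplexPts_subset hq) ht') (fun l hl => by simp [h l hl])
      rw [sum_add_apply, sum_add_apply] at this
      linarith)
    have hf : ∀ l, l ≠ i → fractVec (q + t) l = (q + t) l := fun l hl =>
      fractVec_apply_eq (hs0 l) (hlt l hl)
    have hbox := fractVec_mem hsingle (mem_of_mem_simplexMonoid hs)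
    refine ⟨insert (fractVec (q + t)) C, ?_, ?_⟩
    · rw [Finset.card_insert_of_notMem]
      · omega
      · intro hmem
        have h := (hC _ hmem).2.2
        have := hmin t ht (fun l hl => le_antisymm (hle l) (by rw [← hf l hl]; exact h l hl))
        rw [sum_add_apply, hq.2.2] at this
        linarith
    · intro e he
      rcases Finset.mem_insert.1 he with rfl | he
      · refine ⟨hbox, ?_, fun l hl => (hf l hl).le⟩
        by_cases hmem : fractVec (q + t) ∈ simplexMonoid Λ
        · have h1 := hmin _ hmem hf
          have h2 : (1 : ℝ) ≤ n := by exact_mod_cast hn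
          rw [hsum] at h1
          push_cast at h1
          linarith
        · exact two_le_sum_of_notMem hint hbox.1 (fun l => (hbox.2 l).1) hmem
      · obtain ⟨h1, h2, h3⟩ := hC e he
        exact ⟨h1, h2, fun l hl => (h3 l hl).trans (hle l)⟩

/-- The chain attached to a point of the box: `N` is minimal with `γ + N eᵢ` in the monoid. -/
theorem exists_chain_of_mem_boxPts (hsingle : ∀ i, Pi.single i (1 : ℝ) ∈ Λ)
    (hint : ∀ c ∈ Λ, ∃ z : ℤ, ∑ i, c i = z)
    (hva : ∀ γ ∈ boxPts Λ, ∀ i, ∃ N : ℕ, γ + Pi.single i (N : ℝ) ∈ simplexMonoid Λ)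
    {γ : ι → ℝ} (hγ : γ ∈ boxPts Λ) (i : ι) :
    ∃ N : ℕ, γ + Pi.single i (N : ℝ) ∈ simplexMonoid Λ ∧
      (γ ∈ simplexMonoid Λ → N = 0) ∧
      ∃ C : Finset (ι → ℝ), (N : ℝ) + ∑ l, γ l ≤ C.card + 1 ∧
        ∀ e ∈ C, e ∈ boxPts Λ ∧ 2 ≤ ∑ l, e l ∧ ∀ l, l ≠ i → e l ≤ γ l := by
  classical
  obtain ⟨N, hN, hmin⟩ : ∃ N : ℕ, γ + Pi.single i (N : ℝ) ∈ simplexMonoid Λ ∧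
      ∀ M : ℕ, γ + Pi.single i (M : ℝ) ∈ simplexMonoid Λ → N ≤ M :=
    ⟨Nat.find (hva γ hγ i), Nat.find_spec (hva γ hγ i), fun M hM => Nat.find_min' _ hM⟩
  have hoff : ∀ l, l ≠ i → (γ + Pi.single i (N : ℝ) : ι → ℝ) l = γ l := fun l hl => by simp [hl]
  obtain ⟨z, hz⟩ := hint γ hγ.1
  have hz0 : 0 ≤ z := by
    have : 0 ≤ ∑ l, γ l := Finset.sum_nonneg fun l _ => (hγ.2 l).1
    rw [hz] at this
    exact_mod_cast this
  lift z to ℕ using hz0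
  have hsum : ∑ l, (γ + Pi.single i (N : ℝ) : ι → ℝ) l = ((N + z : ℕ) : ℝ) := by
    rw [sum_add_apply, hz]
    simp [add_comm]
  refine ⟨N, hN, fun h => ?_, ?_⟩
  · exact Nat.le_zero.1 (hmin 0 (by simpa using h))
  obtain ⟨C, hcard, hC⟩ := exists_chain hsingle hint i (N + z) _ hN hsum
    (fun l hl => by rw [hoff l hl]; exact (hγ.2 l).2) (by
      intro t ht h
      obtain ⟨y, hy⟩ := hint t (mem_of_mem_simplexMonoid ht)
      have hdiff : t i = γ i + ((y - z : ℤ) : ℝ) := by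
        have h1 := Finset.add_sum_erase _ t (Finset.mem_univ i)
        have h2 := Finset.add_sum_erase _ γ (Finset.mem_univ i)
        rw [Finset.sum_congr rfl fun l hl =>
          (h l (Finset.ne_of_mem_erase hl)).trans (hoff l (Finset.ne_of_mem_erase hl)), hy] at h1
        rw [hz] at h2
        push_cast at h2 ⊢
        linarith
      have hpos : 0 ≤ y - z := by
        have h1 := nonneg_of_mem_simplexMonoid ht i
        have h2 := (hγ.2 i).2
        simp only [Pi.zero_apply] at h1
        have h3 : (-1 : ℝ) < ((y - z : ℤ) : ℝ) := by linarith
        have h4 : -1 < y - z := by exact_mod_cast h3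
        omega
      obtain ⟨M, hM⟩ := Int.eq_ofNat_of_zero_le hpos
      have hteq : t = γ + Pi.single i (M : ℝ) := by
        ext l
        by_cases hl : l = i
        · subst hl
          rw [hdiff, hM]
          simp
        · rw [h l hl, hoff l hl]
          simp [hl]
      have hNM : (N : ℝ) ≤ M := by exact_mod_cast hmin M (hteq ▸ ht)
      rw [hteq, sum_add_apply, sum_add_apply]
      simpa using hNM)
  refine ⟨C, ?_, fun e he => ?_⟩
  · rw [hz]
    exact_mod_cast hcard
  · obtain ⟨h1, h2, h3⟩ := hC e he
    exact ⟨h1, h2, fun l hl => (h3 l hl).trans (hoff l hl).le⟩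

/-- A point `g + a` outside the monoid forces many points of height at least two in the box. -/
theorem exists_finset_of_notMem [Nonempty ι] (hsingle : ∀ i, Pi.single i (1 : ℝ) ∈ Λ)
    (hint : ∀ c ∈ Λ, ∃ z : ℤ, ∑ i, c i = z)
    (hva : ∀ γ ∈ boxPts Λ, ∀ i, ∃ N : ℕ, γ + Pi.single i (N : ℝ) ∈ simplexMonoid Λ)
    (hfin : (boxPts Λ).Finite) (n : ℕ) :
    ∀ g ∈ boxPts Λ, ∑ i, g i ≤ n → ∀ a : ι → ℕ, g + (fun i => (a i : ℝ)) ∉ simplexMonoid Λ →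
      ∃ E : Finset (ι → ℝ), ∑ i, a i + Fintype.card ι + 1 ≤ E.card ∧
        ∀ e ∈ E, e ∈ boxPts Λ ∧ 2 ≤ ∑ l, e l ∧ ∃ i, ∀ l, l ≠ i → e l ≤ g l := by
  classical
  induction n with
  | zero =>
    intro g hg hn a ha
    have h0 : g = 0 := eq_zero_of_sum_eq_zero (fun l => (hg.2 l).1)
      (le_antisymm (by simpa using hn) (Finset.sum_nonneg fun l _ => (hg.2 l).1))
    subst h0
    exact absurd (by simpa using natVec_mem hsingle a) ha
  | succ n ih =>
    intro g hg hn a ha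
    have hg0 : g ≠ 0 := by
      rintro rfl
      exact absurd (by simpa using natVec_mem hsingle a) ha
    obtain ⟨γ, ⟨hγ, hγ0, hγg⟩, hγmin⟩ :=
      (hfin.subset (fun e he => he.1 : {e | e ∈ boxPts Λ ∧ e ≠ 0 ∧ e ≤ g} ⊆ boxPts Λ)).exists_minimal
        ⟨g, hg, hg0, le_rfl⟩
    choose N hN hN0 C hcard hC using exists_chain_of_mem_boxPts hsingle hint hva hγ
    by_cases hcase : ∃ i, N i ≤ a i
    · obtain ⟨i, hi⟩ := hcase
      set g' := g - γ with hg'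
      set a' : ι → ℕ := Function.update a i (a i - N i) with ha'
      have hg'box : g' ∈ boxPts Λ := ⟨Λ.sub_mem hg.1 hγ.1, fun l => by
        have h1 := hγg l
        have h2 := (hγ.2 l).1
        have h3 := (hg.2 l).2
        simp only [hg', Pi.sub_apply]
        constructor <;> linarith⟩
      have haa' : (fun l => (a l : ℝ)) = (fun l => (a' l : ℝ)) + Pi.single i (N i : ℝ) := by
        ext l
        by_cases hl : l = i
        · subst hl
          simp [ha', Nat.cast_sub hi]
        · simp [ha', hl]
      have hsuma : ∑ l, a l = ∑ l, a' l + N i := by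
        have h := congrArg (fun f : ι → ℝ => ∑ l, f l) haa'
        simp only [sum_add_apply] at h
        simp only [Finset.sum_pi_single', Finset.mem_univ, if_true] at h
        exact_mod_cast h
      have hhole : g' + (fun l => (a' l : ℝ)) ∉ simplexMonoid Λ := by
        intro h
        apply ha
        have : g + (fun l => (a l : ℝ)) =
            (γ + Pi.single i (N i : ℝ)) + (g' + fun l => (a' l : ℝ)) := by
          rw [haa', hg']
          abel
        rw [this]
        exact add_mem (hN i) h
      have hg'S : g' ∉ simplexMonoid Λ := fun h => hhole (add_mem h (natVec_mem hsingle a'))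
      have h2g' := two_le_sum_of_notMem hint hg'box.1 (fun l => (hg'box.2 l).1) hg'S
      have hγ1 : 1 ≤ ∑ l, γ l := by
        obtain ⟨z, hz⟩ := hint γ hγ.1
        have h0 : 0 ≤ ∑ l, γ l := Finset.sum_nonneg fun l _ => (hγ.2 l).1
        have h1 : ∑ l, γ l ≠ 0 := fun h => hγ0 (eq_zero_of_sum_eq_zero (fun l => (hγ.2 l).1) h)
        rw [hz] at h0 h1 ⊢
        have h0' : 0 ≤ z := by exact_mod_cast h0
        have h1' : z ≠ 0 := by exact_mod_cast h1
        have : 1 ≤ z := by omega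
        exact_mod_cast this
      have hgsum : ∑ l, g l = ∑ l, g' l + ∑ l, γ l := by
        rw [← sum_add_apply, hg', sub_add_cancel]
      obtain ⟨E, hE, hEp⟩ := ih g' hg'box (by push_cast at hn; linarith) a' hhole
      have hoff : ∀ e ∈ C i, ∀ l, l ≠ i → fractVec (g' + e) l = g' l + e l := by
        intro e he l hl
        obtain ⟨h1, -, h3⟩ := hC i e he
        refine fractVec_apply_eq (add_nonneg (hg'box.2 l).1 (h1.2 l).1) ?_
        have h4 := h3 l hl
        have h5 := (hg.2 l).2
        simp only [Pi.add_apply, hg', Pi.sub_apply]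
        linarith
      have hdisj : Disjoint E ((C i).image fun e => fractVec (g' + e)) := by
        rw [Finset.disjoint_left]
        intro x hx hx'
        obtain ⟨e, he, rfl⟩ := Finset.mem_image.1 hx'
        obtain ⟨-, -, i', hi'⟩ := hEp _ hx
        obtain ⟨h1, h2, -⟩ := hC i e he
        have hz : ∀ l, l ≠ i → l ≠ i' → e l = 0 := by
          intro l hl hl'
          have h3 := hi' l hl'
          rw [hoff e he l hl] at h3
          have h4 := (h1.2 l).1
          linarith
        have hlt : ∑ l, e l < 2 := by
          have h3 : ∑ l, e l = ∑ l ∈ {i, i'}, e l := by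
            refine (Finset.sum_subset (Finset.subset_univ _) fun l _ hl => ?_).symm
            simp only [Finset.mem_insert, Finset.mem_singleton, not_or] at hl
            exact hz l hl.1 hl.2
          rw [h3]
          by_cases hii : i = i'
          · subst hii
            have := (h1.2 i).2
            simp only [Finset.pair_eq_singleton, Finset.sum_singleton]
            linarith
          · rw [Finset.sum_pair hii]
            linarith [(h1.2 i).2, (h1.2 i').2]
        linarith
      refine ⟨E ∪ (C i).image fun e => fractVec (g' + e), ?_, ?_⟩
      · rw [Finset.card_union_of_disjoint hdisj, Finset.card_image_of_injOn
          ((fractVec_add_injOn (Λ := Λ) g').mono fun e he => (hC i e he).1)]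
        have h1 : (N i : ℝ) ≤ (C i).card := by linarith [hcard i]
        have h2 : N i ≤ (C i).card := by exact_mod_cast h1
        omega
      · intro x hx
        rcases Finset.mem_union.1 hx with hx | hx
        · obtain ⟨h1, h2, i', hi'⟩ := hEp x hx
          exact ⟨h1, h2, i', fun l hl => (hi' l hl).trans (by
            simp only [hg', Pi.sub_apply]
            linarith [(hγ.2 l).1])⟩
        · obtain ⟨e, he, rfl⟩ := Finset.mem_image.1 hx
          obtain ⟨h1, h2, h3⟩ := hC i e he
          have hbox : fractVec (g' + e) ∈ boxPts Λ :=
            fractVec_mem hsingle (Λ.add_mem hg'box.1 h1.1)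
          refine ⟨hbox, ?_, i, fun l hl => ?_⟩
          · obtain ⟨z, hz⟩ := hint _ hbox.1
            have h4 : ∑ l, g' l - 1 < ∑ l, fractVec (g' + e) l := by
              rw [← Finset.add_sum_erase _ g' (Finset.mem_univ i),
                ← Finset.add_sum_erase _ (fractVec (g' + e)) (Finset.mem_univ i)]
              have h5 : ∑ l ∈ Finset.univ.erase i, g' l ≤
                  ∑ l ∈ Finset.univ.erase i, fractVec (g' + e) l := by
                refine Finset.sum_le_sum fun l hl => ?_
                rw [hoff e he l (Finset.ne_of_mem_erase hl)]
                linarith [(h1.2 l).1]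
              linarith [(hg'box.2 i).2, (hbox.2 i).1]
            rw [hz] at h4 ⊢
            have h6 : (1 : ℝ) < z := by linarith
            have h7 : 1 < z := by exact_mod_cast h6
            have h8 : 2 ≤ z := by omega
            exact_mod_cast h8
          · rw [hoff e he l hl]
            have := h3 l hl
            simp only [hg', Pi.sub_apply]
            linarith
    · push Not at hcase
      have hγS : γ ∉ simplexMonoid Λ := by
        intro h
        obtain ⟨i⟩ := ‹Nonempty ι›
        have := hN0 i h
        have := hcase i
        omega
      have h2γ := two_le_sum_of_notMem hint hγ.1 (fun l => (hγ.2 l).1) hγS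
      have heq : ∀ e ∈ boxPts Λ, 2 ≤ ∑ l, e l → e ≤ γ → e = γ := by
        intro e he h2 hle
        refine le_antisymm hle (hγmin ⟨he, ?_, hle.trans hγg⟩ hle)
        rintro rfl
        simp at h2
        linarith
      have hdisj : (↑(Finset.univ : Finset ι) : Set ι).PairwiseDisjoint
          (fun i => (C i).erase γ) := by
        intro i _ j _ hij
        rw [Function.onFun, Finset.disjoint_left]
        intro e he he'
        obtain ⟨hne, he⟩ := Finset.mem_erase.1 he
        obtain ⟨h1, h2, h3⟩ := hC i e he
        obtain ⟨-, -, h3'⟩ := hC j e (Finset.mem_erase.1 he').2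
        refine hne (heq e h1 h2 fun l => ?_)
        by_cases hl : l = i
        · exact h3' l (hl ▸ hij)
        · exact h3 l hl
      refine ⟨insert γ (Finset.univ.biUnion fun i => (C i).erase γ), ?_, ?_⟩
      · rw [Finset.card_insert_of_notMem (by simp), Finset.card_biUnion hdisj]
        have h1 : ∀ i, a i + 1 ≤ ((C i).erase γ).card := by
          intro i
          have h3 : (N i : ℝ) + 1 ≤ (C i).card := by linarith [hcard i]
          have h4 : N i + 1 ≤ (C i).card := by exact_mod_cast h3
          have h5 := Finset.pred_card_le_card_erase (s := C i) (a := γ)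
          have h6 := hcase i
          omega
        have h2 := Finset.sum_le_sum fun i (_ : i ∈ Finset.univ) => h1 i
        rw [Finset.sum_add_distrib] at h2
        simp only [Finset.sum_const, Finset.card_univ, smul_eq_mul, mul_one] at h2
        omega
      · intro e he
        rcases Finset.mem_insert.1 he with rfl | he
        · obtain ⟨i⟩ := ‹Nonempty ι›
          exact ⟨hγ, h2γ, i, fun l _ => hγg l⟩
        · obtain ⟨i, -, he⟩ := Finset.mem_biUnion.1 he
          obtain ⟨h1, h2, h3⟩ := hC i e (Finset.mem_erase.1 he).2
          exact ⟨h1, h2, i, fun l hl => (h3 l hl).trans (hγg l)⟩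

theorem card_simplexPts_le (hfin : (boxPts Λ).Finite)
    {E : Finset (ι → ℝ)} (hE : ∀ e ∈ E, e ∈ boxPts Λ ∧ 2 ≤ ∑ l, e l) :
    (simplexPts Λ).ncard + E.card + 1 ≤ (boxPts Λ).ncard + Fintype.card ι := by
  classical
  set V : Finset (ι → ℝ) := Finset.univ.image fun i => Pi.single i (1 : ℝ) with hV
  set B := hfin.toFinset with hB
  have hVcard : V.card ≤ Fintype.card ι := Finset.card_image_le
  set A := B.filter fun c => ∑ l, c l = 1 with hA
  have hsub : simplexPts Λ ⊆ ↑(V ∪ A) := by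
    intro c hc
    simp only [Finset.coe_union, Set.mem_union, Finset.mem_coe]
    by_cases h : ∀ i, c i < 1
    · right
      simp only [hA, hB, Finset.mem_filter, Set.Finite.mem_toFinset]
      exact ⟨⟨hc.1, fun i => ⟨hc.2.1 i, h i⟩⟩, hc.2.2⟩
    · left
      push Not at h
      obtain ⟨i, hi⟩ := h
      refine Finset.mem_image.2 ⟨i, Finset.mem_univ i, ?_⟩
      have h1 := Finset.add_sum_erase _ c (Finset.mem_univ i)
      rw [hc.2.2] at h1
      have h2 : 0 ≤ ∑ l ∈ Finset.univ.erase i, c l := Finset.sum_nonneg fun l _ => hc.2.1 l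
      have h3 := (Finset.sum_eq_zero_iff_of_nonneg (s := Finset.univ.erase i)
        fun l _ => hc.2.1 l).1 (by linarith)
      ext l
      by_cases hl : l = i
      · subst hl
        simp only [Pi.single_eq_same]
        linarith
      · rw [Pi.single_eq_of_ne hl, h3 l (Finset.mem_erase.2 ⟨hl, Finset.mem_univ l⟩)]
  have h1 : (simplexPts Λ).ncard ≤ V.card + A.card := by
    refine (Set.ncard_le_ncard hsub (Finset.finite_toSet _)).trans ?_
    rw [Set.ncard_coe_finset]
    exact Finset.card_union_le _ _
  have h2 : insert 0 (A ∪ E) ⊆ B := by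
    intro c hc
    rcases Finset.mem_insert.1 hc with rfl | hc
    · simp only [hB, Set.Finite.mem_toFinset]
      exact ⟨Λ.zero_mem, fun i => by simp⟩
    · rcases Finset.mem_union.1 hc with hc | hc
      · exact Finset.mem_of_mem_filter c hc
      · simpa [hB] using (hE c hc).1
  have h3 := Finset.card_le_card h2
  rw [Finset.card_insert_of_notMem, Finset.card_union_of_disjoint] at h3
  · rw [Set.ncard_eq_toFinset_card _ hfin, ← hB]
    omega
  · rw [Finset.disjoint_left]
    intro c hc hc'
    have h4 := (Finset.mem_filter.1 hc).2
    have h5 := (hE c hc').2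
    linarith
  · intro h
    rcases Finset.mem_union.1 h with h | h
    · have := (Finset.mem_filter.1 h).2
      simp at this
    · have := (hE _ h).2
      simp at this
      linarith

/-- Every element of `Λ` of sufficiently large height in the positive orthant lies in the monoid. -/
theorem mem_simplexMonoid_of_card_le [Nonempty ι] (hsingle : ∀ i, Pi.single i (1 : ℝ) ∈ Λ)
    (hint : ∀ c ∈ Λ, ∃ z : ℤ, ∑ i, c i = z)
    (hva : ∀ γ ∈ boxPts Λ, ∀ i, ∃ N : ℕ, γ + Pi.single i (N : ℝ) ∈ simplexMonoid Λ)
    (hfin : (boxPts Λ).Finite) {c : ι → ℝ} (hc : c ∈ Λ) (h0 : 0 ≤ c) {k : ℕ}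
    (hk : ∑ i, c i = k)
    (hle : (boxPts Λ).ncard + Fintype.card ι ≤ (simplexPts Λ).ncard + k) :
    c ∈ simplexMonoid Λ := by
  by_contra hcS
  set a : ι → ℕ := fun i => ⌊c i⌋₊ with ha
  have hdecomp : c = fractVec c + fun i => (a i : ℝ) := by
    ext i
    have h1 : (⌊c i⌋₊ : ℝ) = (⌊c i⌋ : ℝ) := by
      rw [← natCast_floor_eq_intCast_floor (h0 i)]
    simp only [fractVec, Pi.add_apply, ha, h1]
    exact (Int.fract_add_floor _).symm
  have hbox := fractVec_mem hsingle hc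
  obtain ⟨n, hn⟩ := exists_nat_ge (∑ i, fractVec c i)
  obtain ⟨E, hE, hEp⟩ := exists_finset_of_notMem hsingle hint hva hfin n _ hbox hn a
    (hdecomp ▸ hcS)
  have h1 := card_simplexPts_le hfin fun e he => ⟨(hEp e he).1, (hEp e he).2.1⟩
  have h2 : (k : ℝ) ≤ Fintype.card ι + ∑ i, (a i : ℝ) := by
    have h4 := congrArg (fun f : ι → ℝ => ∑ i, f i) hdecomp
    simp only [sum_add_apply, hk] at h4
    rw [h4]
    have h3 : ∑ i, fractVec c i ≤ ∑ _i : ι, (1 : ℝ) :=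
      Finset.sum_le_sum fun i _ => (hbox.2 i).2.le
    simp only [Finset.sum_const, Finset.card_univ, nsmul_eq_mul, mul_one] at h3
    linarith
  have h3 : k ≤ Fintype.card ι + ∑ i, a i := by exact_mod_cast h2
  omega

end Monoid

section Barycentric

variable {d : ℕ} {ι : Type*} [Fintype ι]

theorem isLatticePt_zero : IsLatticePt (0 : Fin d → ℝ) := fun _ => ⟨0, by simp⟩

theorem IsLatticePt.add {x y : Fin d → ℝ} (hx : IsLatticePt x) (hy : IsLatticePt y) :
    IsLatticePt (x + y) := fun i => by
  obtain ⟨a, ha⟩ := hx i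
  obtain ⟨b, hb⟩ := hy i
  exact ⟨a + b, by simp [ha, hb]⟩

theorem IsLatticePt.neg {x : Fin d → ℝ} (hx : IsLatticePt x) : IsLatticePt (-x) := fun i => by
  obtain ⟨a, ha⟩ := hx i
  exact ⟨-a, by simp [ha]⟩

theorem IsLatticePt.int_smul {x : Fin d → ℝ} (hx : IsLatticePt x) (z : ℤ) :
    IsLatticePt ((z : ℝ) • x) := fun i => by
  obtain ⟨a, ha⟩ := hx i
  exact ⟨z * a, by simp [ha]⟩

/-- The homogeneous barycentric coordinates, with respect to `v`, of the lattice points of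
integral height. -/
def baryLattice (v : ι → Fin d → ℝ) : AddSubgroup (ι → ℝ) where
  carrier := {c | IsLatticePt (Fintype.linearCombination ℝ v c) ∧ ∃ z : ℤ, ∑ i, c i = z}
  zero_mem' := ⟨by simpa using isLatticePt_zero, 0, by simp⟩
  add_mem' := by
    rintro x y ⟨hx, a, ha⟩ ⟨hy, b, hb⟩
    exact ⟨by simpa only [map_add] using hx.add hy, a + b, by rw [sum_add_apply, ha, hb]; simp⟩
  neg_mem' := by
    rintro x ⟨hx, a, ha⟩
    exact ⟨by simpa only [map_neg] using hx.neg, -a, by simp [ha]⟩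

variable {v : ι → Fin d → ℝ}

theorem single_mem_baryLattice [DecidableEq ι] (hlat : ∀ i, IsLatticePt (v i)) (i : ι) :
    Pi.single i (1 : ℝ) ∈ baryLattice v :=
  ⟨by simpa [Fintype.linearCombination_apply_single] using hlat i, 1, by simp⟩

theorem mem_convexHull_range_iff {x : Fin d → ℝ} :
    x ∈ convexHull ℝ (Set.range v) ↔
      ∃ c : ι → ℝ, 0 ≤ c ∧ ∑ i, c i = 1 ∧ Fintype.linearCombination ℝ v c = x := by
  classical
  have h : convexHull ℝ (Set.range v) = Fintype.linearCombination ℝ v '' stdSimplex ℝ ι := by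
    rw [← convexHull_rangle_single_eq_stdSimplex, LinearMap.image_convexHull, ← Set.range_comp]
    congr 2
    ext1 i
    simp [Fintype.linearCombination_apply_single]
  rw [h]
  exact ⟨fun ⟨c, hc, hx⟩ => ⟨c, hc.1, hc.2, hx⟩, fun ⟨c, h0, h1, hx⟩ => ⟨c, ⟨h0, h1⟩, hx⟩⟩

theorem AffineIndependent.linearCombination_inj (hind : AffineIndependent ℝ v) {c c' : ι → ℝ}
    (hsum : ∑ i, c i = ∑ i, c' i)
    (h : Fintype.linearCombination ℝ v c = Fintype.linearCombination ℝ v c') : c = c' := by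
  rw [affineIndependent_iff] at hind
  ext i
  refine sub_eq_zero.1 (hind Finset.univ (c - c') ?_ ?_ i (Finset.mem_univ i))
  · simp [hsum]
  · rw [← sub_eq_zero, ← map_sub, Fintype.linearCombination_apply] at h
    exact h

theorem mem_latticePts_iff {x : Fin d → ℝ} :
    x ∈ latticePts (convexHull ℝ (Set.range v)) ↔
      ∃ c ∈ simplexPts (baryLattice v), Fintype.linearCombination ℝ v c = x := by
  constructor
  · rintro ⟨hx, hlat⟩
    obtain ⟨c, h0, h1, rfl⟩ := mem_convexHull_range_iff.1 hx
    exact ⟨c, ⟨⟨hlat, 1, by simp [h1]⟩, h0, h1⟩, rfl⟩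
  · rintro ⟨c, hc, rfl⟩
    exact ⟨mem_convexHull_range_iff.2 ⟨c, hc.2.1, hc.2.2, rfl⟩, hc.1.1⟩

theorem AffineIndependent.ncard_latticePts (hind : AffineIndependent ℝ v) :
    (latticePts (convexHull ℝ (Set.range v))).ncard = (simplexPts (baryLattice v)).ncard := by
  have h : latticePts (convexHull ℝ (Set.range v)) =
      Fintype.linearCombination ℝ v '' simplexPts (baryLattice v) :=
    Set.ext fun _ => mem_latticePts_iff
  rw [h]
  refine Set.InjOn.ncard_image fun c hc c' hc' hcc => ?_
  exact hind.linearCombination_inj (hc.2.2.trans hc'.2.2.symm) hcc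

theorem AffineIndependent.mem_extremePoints_convexHull (hind : AffineIndependent ℝ v) (i : ι) :
    v i ∈ (convexHull ℝ (Set.range v)).extremePoints ℝ := by
  classical
  rw [mem_extremePoints]
  refine ⟨subset_convexHull _ _ ⟨i, rfl⟩, ?_⟩
  suffices h : ∀ x ∈ convexHull ℝ (Set.range v), ∀ y ∈ convexHull ℝ (Set.range v),
      v i ∈ openSegment ℝ x y → x = v i by
    refine fun x hx y hy hxy => ⟨h x hx y hy hxy, h y hy x hx ?_⟩
    rwa [openSegment_symm]
  rintro x hx y hy ⟨a, b, ha, hb, hab, hxy⟩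
  obtain ⟨c, hc0, hc1, rfl⟩ := mem_convexHull_range_iff.1 hx
  obtain ⟨e, he0, he1, rfl⟩ := mem_convexHull_range_iff.1 hy
  have h : a • c + b • e = Pi.single i 1 := by
    refine hind.linearCombination_inj ?_ ?_
    · rw [sum_add_apply]
      simp [← Finset.mul_sum, hc1, he1, hab]
    · rw [map_add, map_smul, map_smul, hxy, Fintype.linearCombination_apply_single, one_smul]
  have hz : ∀ l, l ≠ i → c l = 0 := by
    intro l hl
    have h1 := congrFun h l
    simp only [Pi.add_apply, Pi.smul_apply, smul_eq_mul, Pi.single_eq_of_ne hl] at h1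
    have h2 := mul_nonneg ha.le (hc0 l)
    have h3 := mul_nonneg hb.le (he0 l)
    have h4 : a * c l = 0 := by linarith
    exact (mul_eq_zero.1 h4).resolve_left ha.ne'
  have hc : c = Pi.single i 1 := by
    ext l
    by_cases hl : l = i
    · subst hl
      rw [Finset.sum_eq_single l (fun l' _ h' => hz l' h') (by simp)] at hc1
      simp [hc1]
    · rw [hz l hl, Pi.single_eq_of_ne hl]
  rw [hc, Fintype.linearCombination_apply_single, one_smul]

/-- Very ampleness in barycentric coordinates. -/
theorem exists_add_single_mem_simplexMonoid [DecidableEq ι] (hlat : ∀ i, IsLatticePt (v i))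
    (hind : AffineIndependent ℝ v) (hva : IsVeryAmple (convexHull ℝ (Set.range v)))
    {c : ι → ℝ} (hc : c ∈ baryLattice v) (h0 : 0 ≤ c) (i : ι) :
    ∃ N : ℕ, c + Pi.single i (N : ℝ) ∈ simplexMonoid (baryLattice v) := by
  obtain ⟨hcl, z, hz⟩ := hc
  have hz0 : 0 ≤ z := by
    have : 0 ≤ ∑ l, c l := Finset.sum_nonneg fun l _ => h0 l
    rw [hz] at this
    exact_mod_cast this
  lift z to ℕ using hz0
  rw [Int.cast_natCast] at hz
  rcases Nat.eq_zero_or_pos z with rfl | hpos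
  · rw [eq_zero_of_sum_eq_zero h0 (by simpa using hz)]
    exact ⟨0, by simp⟩
  have hzR : (0 : ℝ) < z := by exact_mod_cast hpos
  obtain ⟨m, u, hu, hsum⟩ := hva (v i) (hind.mem_extremePoints_convexHull i)
    (Fintype.linearCombination ℝ v c - (z : ℝ) • v i)
    (by
      have := hcl.add ((hlat i).int_smul z).neg
      rwa [← sub_eq_add_neg] at this)
    ⟨z, _, ⟨_, mem_convexHull_range_iff.2 ⟨(z : ℝ)⁻¹ • c, smul_nonneg (by positivity) h0, by
        simp [← Finset.mul_sum, hz, hzR.ne'], rfl⟩, rfl⟩, hzR.le, by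
      rw [map_smul, smul_sub, smul_smul, mul_inv_cancel₀ hzR.ne', one_smul]⟩
  choose e he heu using fun j => mem_latticePts_iff.1 (hu j)
  have key : c + Pi.single i (m : ℝ) = ∑ j, e j + Pi.single i (z : ℝ) := by
    refine hind.linearCombination_inj ?_ ?_
    · rw [sum_add_apply, sum_add_apply, hz]
      simp only [Finset.sum_apply]
      rw [Finset.sum_comm]
      simp [fun j => (he j).2.2, add_comm]
    · rw [map_add, map_add, map_sum, Fintype.linearCombination_apply_single,
        Fintype.linearCombination_apply_single]
      simp only [heu]
      rw [Finset.sum_sub_distrib, Finset.sum_const, Finset.card_univ, Fintype.card_fin,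
        ← Nat.cast_smul_eq_nsmul ℝ] at hsum
      rw [sub_eq_sub_iff_add_eq_add] at hsum
      exact hsum
  have hmem : ∑ j, e j ∈ simplexMonoid (baryLattice v) :=
    sum_mem fun j _ => simplexPts_subset (he j)
  have hs := simplexPts_subset (single_mem_simplexPts (single_mem_baryLattice hlat) i)
  have hnat : ∀ n : ℕ, (Pi.single i (n : ℝ) : ι → ℝ) ∈ simplexMonoid (baryLattice v) := by
    intro n
    have := nsmul_mem hs n
    rwa [← Pi.single_smul, nsmul_eq_mul, mul_one] at this
  exact ⟨m, key ▸ add_mem hmem (hnat z)⟩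

theorem isKNormal_convexHull_range [Nonempty ι] (hlat : ∀ i, IsLatticePt (v i))
    (hind : AffineIndependent ℝ v) (hva : IsVeryAmple (convexHull ℝ (Set.range v)))
    (hfin : (boxPts (baryLattice v)).Finite) {k : ℕ}
    (hk : (boxPts (baryLattice v)).ncard + Fintype.card ι ≤
      (simplexPts (baryLattice v)).ncard + k) :
    IsKNormal (convexHull ℝ (Set.range v)) k := by
  classical
  rintro x ⟨⟨y, hy, rfl⟩, hx⟩
  obtain ⟨c, hc0, hc1, rfl⟩ := mem_convexHull_range_iff.1 hy
  have hsum : ∑ i, ((k : ℝ) • c) i = k := by simp [← Finset.mul_sum, hc1]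
  simp only [← map_smul] at hx ⊢
  have hmem : (k : ℝ) • c ∈ simplexMonoid (baryLattice v) :=
    mem_simplexMonoid_of_card_le (single_mem_baryLattice hlat) (fun c hc => hc.2)
      (fun γ hγ i => exists_add_single_mem_simplexMonoid hlat hind hva hγ.1
        (fun l => (hγ.2 l).1) i) hfin ⟨hx, k, by simpa using hsum⟩
      (smul_nonneg k.cast_nonneg hc0) hsum hk
  obtain ⟨u, hu, hsu⟩ := exists_fin_sum_of_mem_simplexMonoid k _ hmem hsum
  exact ⟨fun j => Fintype.linearCombination ℝ v (u j),
    fun j => mem_latticePts_iff.2 ⟨u j, hu j, rfl⟩, by rw [hsu, map_sum]⟩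

end Barycentric

section Volume

variable {d : ℕ}

/-- The full-dimensional standard simplex has volume at least `1 / d!`. -/
theorem one_le_factorial_mul_volume :
    1 ≤ (d.factorial : ENNReal) * volume {x : Fin d → ℝ | 0 ≤ x ∧ ∑ i, x i ≤ 1} := by
  set D := {x : Fin d → ℝ | 0 ≤ x ∧ ∑ i, x i ≤ 1} with hD
  have hball := MeasureTheory.volume_sum_rpow_lt_one (Fin d) (le_refl (1 : ℝ))
  have h2 : (1 : ℝ) / 1 + 1 = (1 : ℕ) + 1 := by norm_num
  rw [h2, Real.Gamma_nat_eq_factorial, Fintype.card_fin, div_one, Real.Gamma_nat_eq_factorial]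
    at hball
  simp only [Real.rpow_one, Nat.factorial_one, Nat.cast_one, mul_one] at hball
  have hsub : {x : Fin d → ℝ | ∑ i, |x i| < 1} ⊆
      ⋃ s : Fin d → ℤˣ, Matrix.toLin' (Matrix.diagonal fun i => ((s i : ℤ) : ℝ)) ⁻¹' D := by
    intro x hx
    refine Set.mem_iUnion.2 ⟨fun i => if 0 ≤ x i then 1 else -1, ?_⟩
    have h : ∀ i, Matrix.toLin' (Matrix.diagonal fun i =>
        (((if 0 ≤ x i then 1 else -1 : ℤˣ) : ℤ) : ℝ)) x i = |x i| := by
      intro i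
      rw [Matrix.toLin'_apply, Matrix.mulVec_diagonal]
      split_ifs with h
      · simp [abs_of_nonneg h]
      · simp [abs_of_neg (not_le.1 h)]
    exact ⟨fun i => by rw [h]; exact abs_nonneg _, by simp only [h]; exact hx.le⟩
  have hvol : ∀ s : Fin d → ℤˣ,
      volume (Matrix.toLin' (Matrix.diagonal fun i => ((s i : ℤ) : ℝ)) ⁻¹' D) = volume D := by
    intro s
    have hdet : |(LinearMap.det (Matrix.toLin' (Matrix.diagonal fun i => ((s i : ℤ) : ℝ))))| = 1 := by
      rw [LinearMap.det_toLin', Matrix.det_diagonal, Finset.abs_prod]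
      refine Finset.prod_eq_one fun i _ => ?_
      rcases Int.units_eq_one_or (s i) with h | h <;> simp [h]
    rw [Measure.addHaar_preimage_linearMap _ (by intro h; simp [h] at hdet), abs_inv, hdet]
    simp
  have h1 := (measure_mono (μ := volume) hsub).trans (measure_iUnion_le _)
  rw [hball] at h1
  simp only [hvol, tsum_fintype, Finset.sum_const, Finset.card_univ, Fintype.card_pi,
    Fintype.card_units_int, Finset.prod_const, Fintype.card_fin, nsmul_eq_mul] at h1
  have hf : (0 : ℝ) < d.factorial := by exact_mod_cast d.factorial_pos
  rw [ENNReal.ofReal_div_of_pos hf, ENNReal.ofReal_pow (by norm_num)] at h1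
  simp only [ENNReal.ofReal_ofNat, ENNReal.ofReal_natCast, Nat.cast_pow, Nat.cast_ofNat] at h1
  rw [ENNReal.div_le_iff (by exact_mod_cast d.factorial_ne_zero) (by simp), mul_assoc] at h1
  have h3 := (ENNReal.mul_le_mul_iff_right (a := 2 ^ d) (by simp) (by simp)).1
    ((mul_one _).le.trans h1)
  rwa [mul_comm] at h3

/-- A set containing an affine image of the standard simplex has normalized volume at least the
absolute value of the determinant of the linear part. -/
theorem abs_det_le_nVol (f : (Fin d → ℝ) →ₗ[ℝ] Fin d → ℝ) (v₀ : Fin d → ℝ)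
    {P : Set (Fin d → ℝ)} (hP : volume P ≠ ⊤)
    (hsub : ∀ x : Fin d → ℝ, 0 ≤ x → ∑ i, x i ≤ 1 → v₀ + f x ∈ P) :
    |LinearMap.det f| ≤ nVol P := by
  set D := {x : Fin d → ℝ | 0 ≤ x ∧ ∑ i, x i ≤ 1} with hD
  have h1 : volume (f '' D) ≤ volume P := by
    rw [← measure_preimage_add volume v₀ P]
    refine measure_mono ?_
    rintro _ ⟨x, hx, rfl⟩
    exact hsub x hx.1 hx.2
  rw [Measure.addHaar_image_linearMap] at h1
  have h2 : ENNReal.ofReal |LinearMap.det f| ≤ d.factorial * volume P :=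
    calc ENNReal.ofReal |LinearMap.det f| = ENNReal.ofReal |LinearMap.det f| * 1 := (mul_one _).symm
      _ ≤ ENNReal.ofReal |LinearMap.det f| * (d.factorial * volume D) := by
        gcongr
        exact one_le_factorial_mul_volume
      _ = d.factorial * (ENNReal.ofReal |LinearMap.det f| * volume D) := by ring
      _ ≤ d.factorial * volume P := by gcongr
  have h3 := ENNReal.toReal_mono (ENNReal.mul_ne_top (by simp) hP) h2
  rwa [ENNReal.toReal_ofReal (abs_nonneg _), ENNReal.toReal_mul, ENNReal.toReal_natCast] at h3

end Volume

/-- The number of cosets of a full-rank sublattice. -/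
theorem card_quotient_range_toLin' {n : Type*} [Fintype n] [DecidableEq n] (W : Matrix n n ℤ)
    (hW : W.det ≠ 0) :
    Nat.card ((n → ℤ) ⧸ LinearMap.range (Matrix.toLin' W)) = W.det.natAbs := by
  have hinj : Function.Injective (Matrix.toLin' W) := by
    rw [← LinearMap.ker_eq_bot]
    exact Matrix.ker_toLin'_eq_bot_iff.2 fun v hv => Matrix.eq_zero_of_mulVec_eq_zero hW hv
  rw [← Submodule.natAbs_det_equiv _ (LinearEquiv.ofInjective _ hinj), ← LinearMap.det_toLin']
  rfl

section EdgeMatrix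

variable {d : ℕ} {v : Fin (d + 1) → Fin d → ℝ}

/-- The matrix whose columns are the edge vectors of the simplex at its zeroth vertex. -/
def edgeMatrix (v : Fin (d + 1) → Fin d → ℝ) : Matrix (Fin d) (Fin d) ℝ :=
  Matrix.of fun i j => v j.succ i - v 0 i

theorem linearCombination_eq_edgeMatrix_mulVec (c : Fin (d + 1) → ℝ) :
    Fintype.linearCombination ℝ v c =
      (∑ i, c i) • v 0 + (edgeMatrix v).mulVec (fun j => c j.succ) := by
  ext i
  simp only [Fintype.linearCombination_apply, Finset.sum_apply, Pi.add_apply, Pi.smul_apply,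
    smul_eq_mul, Matrix.mulVec, dotProduct, edgeMatrix, Matrix.of_apply, Fin.sum_univ_succ,
    add_mul, Finset.sum_mul, add_assoc, ← Finset.sum_add_distrib]
  congr 1
  exact Finset.sum_congr rfl fun j _ => by ring

theorem AffineIndependent.edgeMatrix_mulVec_inj (hind : AffineIndependent ℝ v)
    {x y : Fin d → ℝ} (h : (edgeMatrix v).mulVec x = (edgeMatrix v).mulVec y) : x = y := by
  have key : (Fin.cons (-∑ j, x j) x : Fin (d + 1) → ℝ) = Fin.cons (-∑ j, y j) y := by
    refine hind.linearCombination_inj (by simp [Fin.sum_univ_succ]) ?_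
    rw [linearCombination_eq_edgeMatrix_mulVec, linearCombination_eq_edgeMatrix_mulVec]
    simp [Fin.sum_univ_succ, h]
  exact (Fin.cons_inj.1 key).2

theorem AffineIndependent.det_edgeMatrix_ne_zero (hind : AffineIndependent ℝ v) :
    (edgeMatrix v).det ≠ 0 := by
  intro h
  obtain ⟨x, hx, h0⟩ := Matrix.exists_mulVec_eq_zero_iff.2 h
  exact hx (hind.edgeMatrix_mulVec_inj (by rw [h0, Matrix.mulVec_zero]))

theorem exists_edgeMatrix_eq_map (hlat : ∀ i, IsLatticePt (v i)) :
    ∃ W : Matrix (Fin d) (Fin d) ℤ, edgeMatrix v = W.map (Int.castRingHom ℝ) := by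
  choose z hz using hlat
  exact ⟨Matrix.of fun i j => z j.succ i - z 0 i, by ext i j; simp [edgeMatrix, hz]⟩

theorem AffineIndependent.finite_boxPts_and_ncard_le (hind : AffineIndependent ℝ v)
    (hlat : ∀ i, IsLatticePt (v i)) :
    (boxPts (baryLattice v)).Finite ∧
      ((boxPts (baryLattice v)).ncard : ℝ) ≤ |(edgeMatrix v).det| := by
  obtain ⟨W, hW⟩ := exists_edgeMatrix_eq_map hlat
  have hdet : (edgeMatrix v).det = W.det := by
    rw [hW, ← RingHom.mapMatrix_apply, ← RingHom.map_det]
    rfl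
  have hW0 : W.det ≠ 0 := by
    have := hind.det_edgeMatrix_ne_zero
    rw [hdet] at this
    exact_mod_cast this
  have hcard := card_quotient_range_toLin' W hW0
  have hfinite : Finite ((Fin d → ℤ) ⧸ LinearMap.range (Matrix.toLin' W)) :=
    Nat.finite_of_card_ne_zero (by rw [hcard]; exact Int.natAbs_ne_zero.2 hW0)
  have hy : ∀ c : boxPts (baryLattice v), ∃ y : Fin d → ℤ,
      (edgeMatrix v).mulVec (fun j => c.1 j.succ) = fun i => (y i : ℝ) := by
    rintro ⟨c, ⟨hc, z, hz⟩, -⟩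
    rw [linearCombination_eq_edgeMatrix_mulVec, hz] at hc
    have h := hc.add ((hlat 0).int_smul z).neg
    rw [add_neg_cancel_comm] at h
    choose y hy using h
    exact ⟨y, funext hy⟩
  choose y hy using hy
  have hinj : Function.Injective fun c => Submodule.Quotient.mk
      (p := LinearMap.range (Matrix.toLin' W)) (y c) := by
    intro c c' h
    obtain ⟨n, hn⟩ := (Submodule.Quotient.eq _).1 h
    have h1 : (fun j => c.1 j.succ) = (fun j => c'.1 j.succ) + fun j : Fin d => (n j : ℝ) := by
      refine hind.edgeMatrix_mulVec_inj ?_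
      rw [Matrix.mulVec_add, hy, hy]
      ext i
      have h2 := congrFun hn i
      rw [Matrix.toLin'_apply, Pi.sub_apply] at h2
      have h3 : (edgeMatrix v).mulVec (fun j => (n j : ℝ)) i = ((W.mulVec n i : ℤ) : ℝ) := by
        rw [hW]
        simp [Matrix.mulVec, dotProduct]
      rw [Pi.add_apply, h3, h2]
      push_cast
      ring
    have h4 : ∀ j, ∃ z : ℤ, c.1 j = c'.1 j + z := by
      obtain ⟨a, ha⟩ := c.2.1.2
      obtain ⟨b, hb⟩ := c'.2.1.2
      refine Fin.cases ⟨a - b - ∑ j, n j, ?_⟩ fun j => ⟨n j, congrFun h1 j⟩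
      rw [Fin.sum_univ_succ] at ha hb
      have h5 : ∑ j : Fin d, c.1 j.succ = ∑ j : Fin d, c'.1 j.succ + ∑ j, (n j : ℝ) := by
        rw [← Finset.sum_add_distrib]
        exact Finset.sum_congr rfl fun j _ => congrFun h1 j
      push_cast
      linarith
    refine Subtype.ext (fractVec_add_injOn (Λ := baryLattice v) 0 c.2 c'.2 ?_)
    ext j
    obtain ⟨z, hz⟩ := h4 j
    simp [fractVec, hz]
  refine ⟨Finite.of_injective _ hinj, ?_⟩
  have h := Nat.card_le_card_of_injective _ hinj
  rw [hcard, Nat.card_coe_set_eq] at h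
  rw [hdet, ← Int.cast_abs, Int.abs_eq_natAbs, Int.cast_natCast]
  exact_mod_cast h

theorem abs_det_edgeMatrix_le_nVol (v : Fin (d + 1) → Fin d → ℝ) :
    |(edgeMatrix v).det| ≤ nVol (convexHull ℝ (Set.range v)) := by
  rw [← LinearMap.det_toLin']
  refine abs_det_le_nVol _ (v 0) ?_ fun x h0 h1 => ?_
  · exact ((Set.finite_range v).isCompact_convexHull ℝ).measure_lt_top.ne
  · refine mem_convexHull_range_iff.2 ⟨Fin.cons (1 - ∑ i, x i) x, fun j => ?_, ?_, ?_⟩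
    · refine Fin.cases ?_ (fun j => ?_) j
      · simpa using h1
      · simpa using h0 j
    · simp [Fin.sum_univ_succ]
    · rw [linearCombination_eq_edgeMatrix_mulVec]
      simp [Fin.sum_univ_succ]

end EdgeMatrix

/-- `k_P ≤ Vol(P) - |P ∩ M| + d + 1` for non-hollow very ample simplices. -/
theorem stmt6 {d : ℕ} (v : Fin (d + 1) → Fin d → ℝ)
    (hlat : ∀ i, IsLatticePt (v i)) (hind : AffineIndependent ℝ v)
    (hva : IsVeryAmple (convexHull ℝ (Set.range v)))
    (hnonhollow : (latticePts (interior (convexHull ℝ (Set.range v)))).Nonempty) :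
    (kNormality (convexHull ℝ (Set.range v)) : ℝ) ≤
      nVol (convexHull ℝ (Set.range v)) -
        (latticePts (convexHull ℝ (Set.range v))).ncard + d + 1 := by
  obtain ⟨hfin, hbox⟩ := hind.finite_boxPts_and_ncard_le hlat
  have hQ := card_simplexPts_le hfin (E := ∅) (by simp)
  simp only [Finset.card_empty, Fintype.card_fin] at hQ
  have hk : kNormality (convexHull ℝ (Set.range v)) ≤
      (boxPts (baryLattice v)).ncard + (d + 1) - (simplexPts (baryLattice v)).ncard := by
    refine Nat.sInf_le ⟨by omega, fun k hk => isKNormal_convexHull_range hlat hind hva hfin ?_⟩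
    rw [Fintype.card_fin]
    omega
  have hk' : kNormality (convexHull ℝ (Set.range v)) + (simplexPts (baryLattice v)).ncard ≤
      (boxPts (baryLattice v)).ncard + (d + 1) := by
    omega
  rw [hind.ncard_latticePts]
  have h1 := hbox.trans (abs_det_edgeMatrix_le_nVol v)
  have h2 : (kNormality (convexHull ℝ (Set.range v)) : ℝ) +
      (simplexPts (baryLattice v)).ncard ≤ (boxPts (baryLattice v)).ncard + (d + 1) := by
    exact_mod_cast hk'
  linarith
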